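/- C'(λ)-small cancellation labeling of Θ_n. Let Θ_n be a finite connected graph with all vertex degrees at most D (D ≥ 3 an integer), with diam(Θ_n) ≤ A·girth(Θ_n) for a constant A > 0, and let λ ∈ (0, 1/6] satisfy λ·girth(Θ_n) > 1. Set E := λ/(8λ + 4A) and L̄ := ⌈(4De⁴)^{1/E}⌉ (e the Euler constant). Then there exists a labeling l̄_n of Θ_n over a symmetrized set of L̄ labels that is reduced and such that no two different paths in Θ_n of length at least λ·girth(Θ_n) have the same l̄_n-labeling. -/

import Mathlib

/-- A walk of length `n` without backtracking (a "path" in the sense of the paper),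
encoded by the function of its consecutive vertices. -/
def IsNBPath {V : Type*} (G : SimpleGraph V) (n : ℕ) (f : ℕ → V) : Prop :=
  (∀ i, i < n → G.Adj (f i) (f (i + 1))) ∧ (∀ i, i + 2 ≤ n → f i ≠ f (i + 2))

/-- `ℓ` is a labeling of `G` over a symmetrized alphabet with involution `bar`:
the two orientations of each edge receive mutually inverse labels. -/
def IsLabeling {V Λ : Type*} (G : SimpleGraph V) (bar : Λ → Λ) (ℓ : V → V → Λ) : Prop :=
  ∀ u v, G.Adj u v → ℓ v u = bar (ℓ u v)

/-- A labeling is reduced if no two distinct oriented edges with the same initial vertex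
carry the same label. -/
def IsReducedLabeling {V Λ : Type*} (G : SimpleGraph V) (ℓ : V → V → Λ) : Prop :=
  ∀ u v₁ v₂, G.Adj u v₁ → G.Adj u v₂ → v₁ ≠ v₂ → ℓ u v₁ ≠ ℓ u v₂

section helpers
open Finset

lemma exists_walk_of_fun {V : Type*} (G : SimpleGraph V) (n : ℕ) :
    ∀ (f : ℕ → V), (∀ i, i < n → G.Adj (f i) (f (i + 1))) →
    ∃ w : G.Walk (f 0) (f n), w.length = n ∧ w.support = (List.range (n+1)).map f ∧
      w.edges = (List.range n).map (fun i => s(f i, f (i + 1))) := by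
  induction n with
  | zero => intro f _; exact ⟨SimpleGraph.Walk.nil, by simp⟩
  | succ n ih =>
    intro f h
    obtain ⟨w, h1, h2, h3⟩ := ih (fun i => f (i + 1)) (fun i hi => h (i + 1) (by omega))
    refine ⟨SimpleGraph.Walk.cons (h 0 (by omega)) w, ?_, ?_, ?_⟩
    · simp [h1]
    · rw [List.range_succ_eq_map, SimpleGraph.Walk.support_cons, h2]
      simp [Function.comp_def]
    · rw [List.range_succ_eq_map, SimpleGraph.Walk.edges_cons, h3]
      simp [Function.comp_def]

lemma nb_inj {V : Type*} (G : SimpleGraph V) (n : ℕ) (hn : n < G.girth) :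
    ∀ (f : ℕ → V), IsNBPath G n f → ∀ i j, i < j → j ≤ n → f i ≠ f j := by
  induction n with
  | zero => intro f _ i j h1 h2; omega
  | succ n ih =>
    intro f hf i j hij hj heq
    have hA := ih (by omega) f ⟨fun i hi => hf.1 i (by omega), fun i hi => hf.2 i (by omega)⟩
    have hB := ih (by omega) (fun i => f (i + 1))
      ⟨fun i hi => hf.1 (i + 1) (by omega), fun i hi => hf.2 (i + 1) (by omega)⟩
    have hi0 : i = 0 := by
      by_contra hi
      obtain ⟨i, rfl⟩ := Nat.exists_eq_succ_of_ne_zero hi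
      obtain ⟨j, rfl⟩ : ∃ j', j = j' + 1 := ⟨j - 1, by omega⟩
      exact hB i j (by omega) (by omega) heq
    have hjn : j = n + 1 := by
      by_contra hj'
      exact hA i j hij (by omega) heq
    subst hi0 hjn
    obtain ⟨w, h1, h2, h3⟩ := exists_walk_of_fun G n (fun i => f (i + 1))
      (fun i hi => hf.1 (i + 1) (by omega))
    have hadj : G.Adj (f (n + 1)) (f 1) := heq ▸ hf.1 0 (by omega)
    have hB' : ∀ i j, i ≤ n → j ≤ n → f (i + 1) = f (j + 1) → i = j := by
      intro i j hi hj h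
      rcases lt_trichotomy i j with h' | h' | h'
      · exact absurd h (hB i j h' hj)
      · exact h'
      · exact absurd h.symm (hB j i h' hi)
    have hcyc : (SimpleGraph.Walk.cons hadj w).IsCycle := by
      rw [SimpleGraph.Walk.cons_isCycle_iff]
      constructor
      · rw [SimpleGraph.Walk.isPath_def, h2]
        apply List.Nodup.map_on _ List.nodup_range
        intro a ha b hb hab
        simp only [List.mem_range] at ha hb
        exact hB' a b (by omega) (by omega) hab
      · rw [h3]
        intro hmem
        simp only [List.mem_map, List.mem_range] at hmem
        obtain ⟨m, hm, he⟩ := hmem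
        rw [← heq, Sym2.eq_iff] at he
        rcases he with ⟨_, e2⟩ | ⟨e1, e2⟩
        · have := hB' (m + 1) 0 (by omega) (by omega) e2
          omega
        · have := hB' m 0 (by omega) (by omega) e1
          subst this
          exact hf.2 0 (by omega) e2.symm
    have := hcyc.girth_le_length
    simp only [SimpleGraph.Walk.length_cons, h1] at this
    omega

lemma nb_edge_inj {V : Type*} (G : SimpleGraph V) (n : ℕ) (hn : n < G.girth)
    (f : ℕ → V) (hf : IsNBPath G n f) :
    Function.Injective (fun i : Fin n => s(f i, f (i + 1))) := by
  have h := nb_inj G n hn f hf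
  have h' : ∀ i j, i ≤ n → j ≤ n → f i = f j → i = j := by
    intro i j hi hj e
    rcases lt_trichotomy i j with h' | h' | h'
    · exact absurd e (h i j h' hj)
    · exact h'
    · exact absurd e.symm (h j i h' hi)
  intro i j hij
  simp only [Sym2.eq_iff] at hij
  have := i.2
  have := j.2
  ext
  rcases hij with ⟨e1, e2⟩ | ⟨e1, e2⟩
  · exact h' _ _ (by omega) (by omega) e1
  · have := h' _ _ (by omega) (by omega) e1
    have := h' _ _ (by omega) (by omega) e2
    omega

/-- Counting assignments satisfying `k` equalities. -/
lemma count_bad {α : Type*} [Fintype α] [DecidableEq α] (k M : ℕ) (e e' : Fin k → α)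
    (he : Function.Injective e) (he' : Function.Injective e') (hne : ∀ i, e i ≠ e' i) (hM : 0 < M) :
    (univ.filter (fun x : α → Fin M => ∀ i, x (e i) = x (e' i))).card * M ^ ((k + 1) / 2)
      ≤ M ^ Fintype.card α := by
  let o : α ≃ Fin (Fintype.card α) := Fintype.equivFin α
  let mx : Fin k → α := fun i => if o (e i) < o (e' i) then e' i else e i
  let T : Finset α := univ.image mx
  have hT : k ≤ 2 * T.card := by
    have := Finset.card_le_mul_card_image (f := mx) (univ : Finset (Fin k)) 2 (by
      intro b _
      have hsub : (univ.filter (fun i => mx i = b)) ⊆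
          (univ.filter (fun i => e i = b)) ∪ (univ.filter (fun i => e' i = b)) := by
        intro i
        simp only [mem_filter, mem_union, mem_univ, true_and, mx]
        split_ifs <;> simp_all
      refine (card_le_card hsub).trans ((card_union_le _ _).trans ?_)
      have h1 : (univ.filter (fun i => e i = b)).card ≤ 1 := by
        rw [card_le_one]; intro i hi j hj
        simp only [mem_filter, mem_univ, true_and] at hi hj
        exact he (hi.trans hj.symm)
      have h2 : (univ.filter (fun i => e' i = b)).card ≤ 1 := by
        rw [card_le_one]; intro i hi j hj
        simp only [mem_filter, mem_univ, true_and] at hi hj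
        exact he' (hi.trans hj.symm)
      omega)
    simpa using this
  have hcard : (univ.filter (fun x : α → Fin M => ∀ i, x (e i) = x (e' i))).card
      ≤ M ^ (Tᶜ).card := by
    have : Fintype.card ((Tᶜ : Finset α) → Fin M) = M ^ (Tᶜ).card := by simp [Finset.card_compl]
    rw [← this, ← Finset.card_univ]
    apply Finset.card_le_card_of_injOn (fun x => fun a : (Tᶜ : Finset α) => x a) (by simp)
    intro x hx y hy hxy
    simp only [coe_filter, mem_univ, true_and, Set.mem_ofPred_eq] at hx hy
    have key : ∀ n : ℕ, ∀ a : α, (o a : ℕ) = n → x a = y a := by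
      intro n
      induction n using Nat.strong_induction_on with
      | _ n ih =>
        intro a ha
        by_cases haT : a ∈ T
        · simp only [T, mem_image, mem_univ, true_and, mx] at haT
          obtain ⟨i, hi⟩ := haT
          split_ifs at hi with hlt
          · subst hi
            rw [← hx i, ← hy i]
            exact ih _ (by rw [← ha]; exact hlt) _ rfl
          · subst hi
            rw [hx i, hy i]
            refine ih _ ?_ _ rfl
            rw [← ha]
            have : o (e i) ≠ o (e' i) := fun h => hne i (o.injective h)
            have := lt_of_le_of_ne (not_lt.mp hlt) this.symm
            exact this
        · exact congrFun hxy ⟨a, by simpa using haT⟩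
    ext a
    rw [key _ a rfl]
  calc _ ≤ M ^ (Tᶜ).card * M ^ T.card :=
        Nat.mul_le_mul hcard (Nat.pow_le_pow_right hM (by omega))
    _ = M ^ Fintype.card α := by rw [← pow_add, add_comm, Finset.card_add_card_compl]

lemma exists_good {α I : Type*} [Fintype α] [Fintype I] (k M : ℕ) (hM : 0 < M)
    (e e' : I → Fin k → α) (hI : Fintype.card I < M ^ ((k + 1) / 2)) :
    ∃ x : α → Fin M, ∀ c : I, Function.Injective (e c) → Function.Injective (e' c) →
      (∀ i, e c i ≠ e' c i) → ¬ ∀ i, x (e c i) = x (e' c i) := by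
  classical
  by_contra hcon
  push Not at hcon
  let J : Finset I := univ.filter (fun c => Function.Injective (e c) ∧ Function.Injective (e' c) ∧
      (∀ i, e c i ≠ e' c i))
  have hcov : (univ : Finset (α → Fin M)) ⊆
      J.biUnion (fun c => univ.filter (fun x : α → Fin M => ∀ i, x (e c i) = x (e' c i))) := by
    intro x _
    obtain ⟨c, h1, h2, h3, h4⟩ := hcon x
    simp only [mem_biUnion, mem_filter, mem_univ, true_and, J]
    exact ⟨c, ⟨h1, h2, h3⟩, h4⟩
  have h1 := (card_le_card hcov).trans card_biUnion_le
  have h2 : M ^ Fintype.card α * M ^ ((k + 1) / 2) ≤ Fintype.card I * M ^ Fintype.card α := by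
    calc M ^ Fintype.card α * M ^ ((k + 1) / 2)
        = (univ : Finset (α → Fin M)).card * M ^ ((k + 1) / 2) := by simp
      _ ≤ _ := Nat.mul_le_mul_right _ h1
      _ = _ := Finset.sum_mul _ _ _
      _ ≤ ∑ c ∈ J, M ^ Fintype.card α := by
          apply Finset.sum_le_sum
          intro c hc
          simp only [mem_filter, mem_univ, true_and, J] at hc
          exact count_bad k M _ _ hc.1 hc.2.1 hc.2.2 hM
      _ = J.card * M ^ Fintype.card α := by simp
      _ ≤ _ := Nat.mul_le_mul_right _ (card_le_univ _)
  have h3 : 0 < M ^ Fintype.card α := by positivity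
  nlinarith

/-- closed-neighbourhood enumeration -/
lemma exists_nb {V : Type*} [Fintype V] (G : SimpleGraph V) [DecidableRel G.Adj]
    (D : ℕ) (hdeg : ∀ v : V, G.degree v ≤ D) :
    ∃ nb : V → Fin (D + 1) → V, ∀ u v, (v = u ∨ G.Adj u v) → ∃ i, nb u i = v := by
  classical
  have : ∀ u, ∃ h : Fin (D + 1) → V, ∀ v, (v = u ∨ G.Adj u v) → ∃ i, h i = v := by
    intro u
    let S : Finset V := insert u (G.neighborFinset u)
    have hS : S.card ≤ D + 1 := by
      refine (card_insert_le _ _).trans ?_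
      have := hdeg u
      rw [← SimpleGraph.card_neighborFinset_eq_degree] at this
      omega
    refine ⟨fun i => if h : (i : ℕ) < S.card then (S.equivFin.symm ⟨i, h⟩ : V) else u, ?_⟩
    intro v hv
    have hvS : v ∈ S := by simpa [S] using hv
    refine ⟨⟨S.equivFin ⟨v, hvS⟩, lt_of_lt_of_le (Fin.is_lt _) hS⟩, ?_⟩
    simp
  choose nb h using this
  exact ⟨nb, h⟩

def codeWalk {V : Type*} {D : ℕ} (nb : V → Fin (D + 1) → V) (v : V) (s : ℕ → Fin (D + 1)) : ℕ → V
  | 0 => v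
  | i + 1 => nb (codeWalk nb v s i) (s i)

lemma exists_code {V : Type*} (G : SimpleGraph V) {D : ℕ} (nb : V → Fin (D + 1) → V)
    (hnb : ∀ u v, (v = u ∨ G.Adj u v) → ∃ i, nb u i = v) (n : ℕ) (f : ℕ → V)
    (hf : ∀ i, i < n → f (i + 1) = f i ∨ G.Adj (f i) (f (i + 1))) :
    ∃ s : Fin n → Fin (D + 1), ∀ i, i ≤ n →
      codeWalk nb (f 0) (fun j => if h : j < n then s ⟨j, h⟩ else 0) i = f i := by
  have : ∀ i : Fin n, ∃ t, nb (f i) t = f (i + 1) := fun i => hnb _ _ (hf i i.2)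
  choose s hs using this
  refine ⟨s, ?_⟩
  intro i
  induction i with
  | zero => intro _; rfl
  | succ i ih =>
    intro hi
    rw [codeWalk, ih (by omega), dif_pos (by omega)]
    exact hs ⟨i, by omega⟩

lemma card_le_of_diam {V : Type*} [Fintype V] (G : SimpleGraph V) {D : ℕ}
    (nb : V → Fin (D + 1) → V)
    (hnb : ∀ u v, (v = u ∨ G.Adj u v) → ∃ i, nb u i = v) (hconn : G.Connected) :
    Fintype.card V ≤ (D + 1) ^ G.diam := by
  classical
  have := hconn.nonempty
  obtain ⟨v0⟩ := hconn.nonempty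
  have hsurj : Function.Surjective (fun s : Fin G.diam → Fin (D + 1) =>
      codeWalk nb v0 (fun j => if h : j < G.diam then s ⟨j, h⟩ else 0) G.diam) := by
    intro v
    obtain ⟨w, hw⟩ := hconn.exists_walk_length_eq_dist v0 v
    have hle : w.length ≤ G.diam := by
      rw [hw]
      exact SimpleGraph.dist_le_diam (SimpleGraph.connected_iff_ediam_ne_top.mp hconn)
    obtain ⟨s, hs⟩ := exists_code G nb hnb G.diam w.getVert (by
      intro i _
      by_cases h : i < w.length
      · exact Or.inr (w.adj_getVert_succ h)
      · left
        rw [w.getVert_of_length_le (by omega), w.getVert_of_length_le (by omega)])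
    refine ⟨s, ?_⟩
    have := hs G.diam le_rfl
    rw [w.getVert_of_length_le hle, w.getVert_zero] at this
    exact this
  have := Fintype.card_le_of_surjective _ hsurj
  simpa using this

lemma exists_coloring {V : Type*} [Fintype V] (G : SimpleGraph V) {D : ℕ}
    (nb : V → Fin (D + 1) → V)
    (hnb : ∀ u v, (v = u ∨ G.Adj u v) → ∃ i, nb u i = v) :
    ∃ p : V → Fin ((D + 1) ^ 2 + 1),
      (∀ u v, G.Adj u v → p u ≠ p v) ∧
      (∀ u v w, G.Adj u v → G.Adj u w → v ≠ w → p v ≠ p w) := by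
  classical
  let R : V → V → Prop := fun u v => u ≠ v ∧ ∃ z, (z = u ∨ G.Adj u z) ∧ (v = z ∨ G.Adj z v)
  have hRs : ∀ u v, R u v → R v u := by
    rintro u v ⟨h, z, hz1, hz2⟩
    exact ⟨h.symm, z, hz2.imp Eq.symm SimpleGraph.Adj.symm, hz1.imp Eq.symm SimpleGraph.Adj.symm⟩
  have hcard : ∀ u, (univ.filter (fun v => R u v)).card ≤ (D + 1) ^ 2 := by
    intro u
    have : (univ.filter (fun v => R u v)) ⊆
        (univ : Finset (Fin (D + 1) × Fin (D + 1))).image (fun ij => nb (nb u ij.1) ij.2) := by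
      intro v hv
      simp only [mem_filter, mem_univ, true_and] at hv
      obtain ⟨_, z, hz1, hz2⟩ := hv
      obtain ⟨i, hi⟩ := hnb _ _ hz1
      obtain ⟨j, hj⟩ := hnb _ _ hz2
      simp only [mem_image, mem_univ, true_and]
      exact ⟨(i, j), by simp [hi, hj]⟩
    refine (card_le_card this).trans (card_image_le.trans ?_)
    simp [sq]
  have main : ∀ S : Finset V, ∃ p : V → Fin ((D + 1) ^ 2 + 1),
      ∀ u ∈ S, ∀ v ∈ S, R u v → p u ≠ p v := by
    intro S
    induction S using Finset.induction_on with
    | empty => exact ⟨fun _ => 0, by simp⟩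
    | insert a S ha ih =>
      obtain ⟨p, hp⟩ := ih
      obtain ⟨c, hc⟩ : ∃ c, c ∉ (univ.filter (fun v => R a v)).image p := by
        by_contra hcon
        push Not at hcon
        have h1 : (univ : Finset (Fin ((D + 1) ^ 2 + 1))) ⊆ (univ.filter (fun v => R a v)).image p :=
          fun c _ => hcon c
        have h2 := (card_le_card h1).trans (card_image_le.trans (hcard a))
        simp at h2
      have hc' : ∀ v, R a v → p v ≠ c := by
        intro v hv h
        exact hc (mem_image.mpr ⟨v, by simpa using hv, h⟩)
      refine ⟨Function.update p a c, ?_⟩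
      intro u hu v hv huv
      by_cases hua : u = a
      · subst hua
        rw [Function.update_self, Function.update_of_ne huv.1.symm]
        exact (hc' v huv).symm
      · by_cases hva : v = a
        · subst hva
          rw [Function.update_self, Function.update_of_ne hua]
          exact hc' u (hRs _ _ huv)
        · rw [Function.update_of_ne hua, Function.update_of_ne hva]
          exact hp u (mem_of_mem_insert_of_ne hu hua) v (mem_of_mem_insert_of_ne hv hva) huv
  obtain ⟨p, hp⟩ := main univ
  refine ⟨p, fun u v h => hp u (mem_univ _) v (mem_univ _) ⟨h.ne, v, Or.inr h, Or.inl rfl⟩,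
    fun u v w h1 h2 h3 => hp v (mem_univ _) w (mem_univ _) ⟨h3, u, Or.inr h1.symm, Or.inr h2⟩⟩

/-- The combinatorial core. -/
lemma core {V : Type*} [Fintype V] (G : SimpleGraph V) [DecidableRel G.Adj]
    (D : ℕ) (hconn : G.Connected) (hdeg : ∀ v : V, G.degree v ≤ D)
    (k M L : ℕ) (hk : k < G.girth) (hM : 0 < M)
    (hcount : (D + 1) ^ (2 * G.diam + 2 * k) < M ^ ((k + 1) / 2))
    (hL : ((D + 1) ^ 2 + 1) ^ 2 * M ≤ L) :
    ∃ (Λ : Type) (instΛ : Fintype Λ) (bar : Λ → Λ), Function.Involutive bar ∧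
      @Fintype.card Λ instΛ = L ∧
      ∃ ℓ : V → V → Λ, IsLabeling G bar ℓ ∧ IsReducedLabeling G ℓ ∧
        ∀ (f g : ℕ → V),
          IsNBPath G k f → IsNBPath G k g → (∃ m, m ≤ k ∧ f m ≠ g m) →
          ¬ (∀ m, m < k → ℓ (f m) (f (m + 1)) = ℓ (g m) (g (m + 1))) := by
  classical
  have hk0 : 0 < k := by
    rcases Nat.eq_zero_or_pos k with h | h
    · subst h
      have : 0 < (D + 1) ^ (2 * G.diam + 2 * 0) := by positivity
      simp at hcount
    · exact h
  obtain ⟨nb, hnb⟩ := exists_nb G D hdeg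
  have hV := card_le_of_diam G nb hnb hconn
  obtain ⟨p, hp1, hp2⟩ := exists_coloring G nb hnb
  let W : V × (Fin k → Fin (D + 1)) → ℕ → V := fun c =>
    codeWalk nb c.1 (fun j => if h : j < k then c.2 ⟨j, h⟩ else 0)
  obtain ⟨x, hx⟩ := exists_good (α := Sym2 V)
    (I := (V × (Fin k → Fin (D + 1))) × (V × (Fin k → Fin (D + 1)))) k M hM
    (fun c i => s(W c.1 i, W c.1 (i + 1))) (fun c i => s(W c.2 i, W c.2 (i + 1))) (by
      refine lt_of_le_of_lt ?_ hcount
      simp only [Fintype.card_prod, Fintype.card_fun, Fintype.card_fin]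
      calc _ ≤ ((D + 1) ^ G.diam * (D + 1) ^ k) * ((D + 1) ^ G.diam * (D + 1) ^ k) := by gcongr
        _ = _ := by ring)
  let C := (D + 1) ^ 2 + 1
  refine ⟨(Fin C × Fin C × Fin M) ⊕ Fin (L - C ^ 2 * M), inferInstance,
    Sum.map (fun t => (t.2.1, t.1, t.2.2)) id, ?_, ?_,
    fun u v => Sum.inl (p u, p v, x s(u, v)), ?_, ?_, ?_⟩
  · rintro (t | t) <;> simp
  · simp only [Fintype.card_sum, Fintype.card_prod, Fintype.card_fin]
    have : C * (C * M) = C ^ 2 * M := by ring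
    rw [this]
    have : C ^ 2 * M ≤ L := hL
    omega
  · intro u v _
    simp [Sym2.eq_swap]
  · intro u v w h1 h2 h3 h
    simp only [Sum.inl.injEq, Prod.mk.injEq] at h
    exact hp2 u v w h1 h2 h3 h.2.1
  · rintro f g hf hg ⟨m0, hm0, hne⟩ hlab
    simp only [Sum.inl.injEq, Prod.mk.injEq] at hlab
    -- nowhere equal
    have hfwd : ∀ i, i < k → (f i = g i ↔ f (i + 1) = g (i + 1)) := by
      intro i hi
      obtain ⟨l1, l2, _⟩ := hlab i hi
      constructor
      · intro h
        by_contra hn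
        exact hp2 (f i) _ _ (hf.1 i hi) (h ▸ hg.1 i hi) hn l2
      · intro h
        by_contra hn
        exact hp2 (f (i + 1)) _ _ (hf.1 i hi).symm (h ▸ (hg.1 i hi).symm) hn l1
    have h0 : ∀ i, i ≤ k → (f 0 = g 0 ↔ f i = g i) := by
      intro i
      induction i with
      | zero => intro _; rfl
      | succ i ih => intro hi; exact (ih (by omega)).trans (hfwd i (by omega))
    have hall : ∀ i, i ≤ k → f i ≠ g i := by
      intro i hi h
      exact hne ((h0 m0 hm0).mp ((h0 i hi).mpr h))
    obtain ⟨s, hs⟩ := exists_code G nb hnb k f (fun i hi => Or.inr (hf.1 i hi))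
    obtain ⟨t, ht⟩ := exists_code G nb hnb k g (fun i hi => Or.inr (hg.1 i hi))
    have hWf : ∀ i, i ≤ k → W (f 0, s) i = f i := hs
    have hWg : ∀ i, i ≤ k → W (g 0, t) i = g i := ht
    have e1 : (fun i : Fin k => s(W (f 0, s) i, W (f 0, s) (i + 1))) =
        fun i : Fin k => s(f i, f (i + 1)) := by
      funext i
      have := i.2
      rw [hWf _ (by omega), hWf _ (by omega)]
    have e2 : (fun i : Fin k => s(W (g 0, t) i, W (g 0, t) (i + 1))) =
        fun i : Fin k => s(g i, g (i + 1)) := by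
      funext i
      have := i.2
      rw [hWg _ (by omega), hWg _ (by omega)]
    have hx' := hx ((f 0, s), (g 0, t))
    have e1' := fun i => congrFun e1 i
    have e2' := fun i => congrFun e2 i
    simp only [e1', e2'] at hx'
    refine hx' (nb_edge_inj G k hk f hf) (nb_edge_inj G k hk g hg) ?_ ?_
    · intro i h
      rw [Sym2.eq_iff] at h
      rcases h with ⟨h1, _⟩ | ⟨h1, h2⟩
      · exact hall i (by omega) h1
      · have := (hlab i i.2).1
        rw [← h2] at this
        exact hp1 _ _ (hf.1 i i.2) this
    · intro i
      exact (hlab i i.2).2.2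

end helpers

/-- `C'(λ)`-small cancellation labeling of `Θ_n`: a finite connected graph with degrees at
most `D ≥ 3`, `diam ≤ A·girth`, `λ ∈ (0,1/6]`, `λ·girth > 1`, admits a reduced labeling over
a symmetrized set of `L̄ = ⌈(4·D·e⁴)^(1/E)⌉` labels, `E = λ/(8λ+4A)`, such that no two
different paths of length at least `λ·girth` have the same labeling. -/
theorem statement_5 {V : Type*} [Fintype V] (G : SimpleGraph V) [DecidableRel G.Adj]
    (D : ℕ) (hD : 3 ≤ D) (A lam E : ℝ) (hA : 0 < A)
    (hlam0 : 0 < lam) (hlam6 : lam ≤ 1 / 6)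
    (hconn : G.Connected)
    (hdeg : ∀ v : V, G.degree v ≤ D)
    (hdiam : (G.diam : ℝ) ≤ A * (G.girth : ℝ))
    (hgirth : 1 < lam * (G.girth : ℝ))
    (hE : E = lam / (8 * lam + 4 * A))
    (Lbar : ℕ) (hLbar : Lbar = ⌈(4 * (D : ℝ) * Real.exp 1 ^ 4) ^ (1 / E)⌉₊) :
    ∃ (Λ : Type) (instΛ : Fintype Λ) (bar : Λ → Λ), Function.Involutive bar ∧
      @Fintype.card Λ instΛ = Lbar ∧
      ∃ ℓ : V → V → Λ, IsLabeling G bar ℓ ∧ IsReducedLabeling G ℓ ∧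
        ∀ (k : ℕ) (f g : ℕ → V), lam * (G.girth : ℝ) ≤ (k : ℝ) →
          IsNBPath G k f → IsNBPath G k g → (∃ m, m ≤ k ∧ f m ≠ g m) →
          ¬ (∀ m, m < k → ℓ (f m) (f (m + 1)) = ℓ (g m) (g (m + 1))) := by
  set γ : ℝ := (G.girth : ℝ) with hγ
  have hγ0 : 0 ≤ γ := Nat.cast_nonneg _
  set B : ℝ := 4 * (D : ℝ) * Real.exp 1 ^ 4 with hB
  have hD' : (3 : ℝ) ≤ D := by exact_mod_cast hD
  have he : (1 : ℝ) ≤ Real.exp 1 ^ 4 := one_le_pow₀ (Real.one_le_exp (by norm_num))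
  have hB4 : 4 * (D : ℝ) ≤ B := by rw [hB]; nlinarith
  have hB1 : 1 ≤ B := by linarith
  have hB0 : 0 < B := by linarith
  have hexp : 1 / E = 4 + (4 + 4 * A / lam) := by
    rw [hE]; field_simp; ring
  have hAl : 0 < A / lam := by positivity
  set q : ℝ := 4 + 4 * A / lam with hq
  have hq0 : 0 < q := by positivity
  set k0 : ℕ := ⌈lam * γ⌉₊ with hk0
  have hk1 : lam * γ ≤ k0 := Nat.le_ceil _
  have hk2 : (k0 : ℝ) < lam * γ + 1 := Nat.ceil_lt_add_one (by positivity)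
  have hkg : k0 < G.girth := by
    have : (k0 : ℝ) < (G.girth : ℝ) := by
      rw [← hγ]; nlinarith
    exact_mod_cast this
  set M : ℕ := ⌈B ^ q⌉₊ with hMdef
  have hM1 : B ^ q ≤ M := Nat.le_ceil _
  have hBq : 1 ≤ B ^ q := Real.one_le_rpow hB1 hq0.le
  have hM2 : (M : ℝ) ≤ 2 * B ^ q := by
    have := Nat.ceil_lt_add_one (a := B ^ q) (by linarith)
    rw [← hMdef] at this
    linarith
  have hM0 : 0 < M := by
    have : (0 : ℝ) < M := by linarith
    exact_mod_cast this
  have hcount : (D + 1) ^ (2 * G.diam + 2 * k0) < M ^ ((k0 + 1) / 2) := by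
    have hk0' : 0 < k0 := by
      have : (0 : ℝ) < k0 := by linarith
      exact_mod_cast this
    have hr : (k0 : ℝ) ≤ 2 * (((k0 + 1) / 2 : ℕ) : ℝ) := by
      have : k0 ≤ 2 * ((k0 + 1) / 2) := by omega
      exact_mod_cast this
    have hlt : ((D : ℝ) + 1) ^ (2 * G.diam + 2 * k0) < (M : ℝ) ^ ((k0 + 1) / 2) := by
      calc ((D : ℝ) + 1) ^ (2 * G.diam + 2 * k0) < B ^ (2 * G.diam + 2 * k0) := by
            apply pow_lt_pow_left₀ (by linarith) (by positivity) (by omega)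
        _ = B ^ ((2 * G.diam + 2 * k0 : ℕ) : ℝ) := (Real.rpow_natCast _ _).symm
        _ ≤ B ^ (q * (((k0 + 1) / 2 : ℕ) : ℝ)) := by
            apply Real.rpow_le_rpow_of_exponent_le hB1
            have h1 : A * γ ≤ A / lam * k0 := by
              calc A * γ = A / lam * (lam * γ) := by field_simp
                _ ≤ _ := by gcongr
            have h2 : q * ((k0 : ℝ) / 2) ≤ q * (((k0 + 1) / 2 : ℕ) : ℝ) := by
              gcongr; linarith
            have h3 : q * ((k0 : ℝ) / 2) = 2 * k0 + 2 * (A / lam * k0) := by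
              rw [hq]; ring
            push_cast at h2 ⊢
            linarith
        _ = (B ^ q) ^ ((k0 + 1) / 2) := by rw [Real.rpow_mul hB0.le, Real.rpow_natCast]
        _ ≤ _ := by gcongr
    exact_mod_cast hlt
  have hL : ((D + 1) ^ 2 + 1) ^ 2 * M ≤ Lbar := by
    have hC : ((D : ℝ) + 1) ^ 2 + 1 ≤ 8 * (D : ℝ) ^ 2 := by nlinarith
    have : ((((D : ℝ) + 1) ^ 2 + 1) ^ 2) * (M : ℝ) ≤ Lbar := by
      calc ((((D : ℝ) + 1) ^ 2 + 1) ^ 2) * (M : ℝ)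
          ≤ (8 * (D : ℝ) ^ 2) ^ 2 * (2 * B ^ q) := by gcongr
        _ = (128 * (D : ℝ) ^ 4) * B ^ q := by ring
        _ ≤ (4 * (D : ℝ)) ^ 4 * B ^ q := by
            apply mul_le_mul_of_nonneg_right _ (by linarith)
            have : (0 : ℝ) ≤ (D : ℝ) ^ 4 := by positivity
            nlinarith
        _ ≤ B ^ 4 * B ^ q := by gcongr
        _ = B ^ (1 / E) := by
            rw [hexp, Real.rpow_add hB0 4 q, ← Real.rpow_natCast B 4]
            norm_num
        _ ≤ _ := by rw [hLbar]; exact Nat.le_ceil _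
    exact_mod_cast this
  obtain ⟨Λ, instΛ, bar, h1, h2, ℓ, h3, h4, h5⟩ :=
    core G D hconn hdeg k0 M Lbar hkg hM0 hcount hL
  refine ⟨Λ, instΛ, bar, h1, h2, ℓ, h3, h4, ?_⟩
  rintro k f g hk hf hg ⟨m, hm, hne⟩ hlab
  have hkk : k0 ≤ k := Nat.ceil_le.mpr hk
  -- a window of length `k0` containing `m`
  obtain ⟨a, ha1, ha2, ha3⟩ : ∃ a, a ≤ m ∧ m ≤ a + k0 ∧ a + k0 ≤ k :=
    ⟨m - k0, by omega, by omega, by omega⟩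
  have hshift : ∀ f : ℕ → V, IsNBPath G k f → IsNBPath G k0 (fun i => f (a + i)) := by
    intro f hf
    exact ⟨fun i hi => hf.1 (a + i) (by omega), fun i hi => hf.2 (a + i) (by omega)⟩
  refine h5 _ _ (hshift f hf) (hshift g hg) ⟨m - a, by omega, ?_⟩ ?_
  · have : a + (m - a) = m := by omega
    simpa [this] using hne
  · intro i hi
    exact hlab (a + i) (by omega)
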